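/- arXiv:1304.1076 — 4 statements merged into one kernel-verified Lean document; each statement's English description precedes it below -/
import Mathlib

section
/- For every x ∈ V one has ρ(x) ∘ ρ(x) = (−Q(x)) • id_S, i.e. the map ρ satisfies the Clifford relation for the quadratic form −Q. Consequently there is a unique ℂ-algebra homomorphism ρ̂ from the Clifford algebra of the quadratic form −Q on V to End(S) such that ρ̂(ι(x)) = ρ(x) for all x ∈ V, where ι denotes the canonical linear embedding of V into its Clifford algebra. -/
noncomputable section

open scoped TensorProduct

/-- The `(2m+1)`-dimensional space `V := N × N* × ℂ`. -/
abbrev Vsp (N : Type) [AddCommGroup N] [Module ℂ N] : Type := N × (N →ₗ[ℂ] ℂ) × ℂ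

/-- The bilinear map `B((v,φ,t),(v',φ',t')) = φ(v') − t·t'`, whose diagonal is `Q`. -/
def Bform (N : Type) [AddCommGroup N] [Module ℂ N] : Vsp N →ₗ[ℂ] Vsp N →ₗ[ℂ] ℂ :=
  LinearMap.mk₂ ℂ (fun x y => x.2.1 y.1 - x.2.2 * y.2.2)
    (fun x x' y => by simp only [Prod.fst_add, Prod.snd_add, LinearMap.add_apply]; ring)
    (fun c x y => by
      simp only [Prod.smul_fst, Prod.smul_snd, LinearMap.smul_apply, smul_eq_mul]; ring)
    (fun x y y' => by simp only [Prod.fst_add, Prod.snd_add, map_add]; ring)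
    (fun c x y => by simp only [Prod.smul_fst, Prod.smul_snd, map_smul, smul_eq_mul]; ring)

/-- The quadratic form `Q(v, φ, t) := φ(v) − t²`. -/
def Qform (N : Type) [AddCommGroup N] [Module ℂ N] : QuadraticForm ℂ (Vsp N) :=
  LinearMap.BilinMap.toQuadraticMap (Bform N)

/-- The polar form `g(x,y) := (Q(x+y) − Q(x) − Q(y))/2`. -/
def gform (N : Type) [AddCommGroup N] [Module ℂ N] (x y : Vsp N) : ℂ :=
  (Qform N (x + y) - Qform N x - Qform N y) / 2

/-- `σ` : the involution acting on `⋀^k N` as `(−1)^(m−k)`. -/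
def sigmaMap (m : ℕ) (N : Type) [AddCommGroup N] [Module ℂ N] :
    ExteriorAlgebra ℂ N →ₗ[ℂ] ExteriorAlgebra ℂ N :=
  ((-1 : ℂ) ^ m) • (CliffordAlgebra.involute (Q := (0 : QuadraticForm ℂ N))).toLinearMap

/-- `ρ(v, φ, t)(ξ) := v ∧ ξ − ι_φ(ξ) + t·σ(ξ)`. -/
def rho (m : ℕ) (N : Type) [AddCommGroup N] [Module ℂ N] :
    Vsp N →ₗ[ℂ] ExteriorAlgebra ℂ N →ₗ[ℂ] ExteriorAlgebra ℂ N :=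
  (LinearMap.mul ℂ (ExteriorAlgebra ℂ N) ∘ₗ ExteriorAlgebra.ι ℂ ∘ₗ
      LinearMap.fst ℂ N ((N →ₗ[ℂ] ℂ) × ℂ))
  - (CliffordAlgebra.contractLeft (Q := (0 : QuadraticForm ℂ N)) ∘ₗ
      LinearMap.fst ℂ (N →ₗ[ℂ] ℂ) ℂ ∘ₗ LinearMap.snd ℂ N ((N →ₗ[ℂ] ℂ) × ℂ))
  + (LinearMap.toSpanSingleton ℂ (ExteriorAlgebra ℂ N →ₗ[ℂ] ExteriorAlgebra ℂ N)
        (sigmaMap m N) ∘ₗ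
      LinearMap.snd ℂ (N →ₗ[ℂ] ℂ) ℂ ∘ₗ LinearMap.snd ℂ N ((N →ₗ[ℂ] ℂ) × ℂ))

/-- `K_ξ := {x ∈ V : ρ(x)(ξ) = 0}`. -/
def Kker (m : ℕ) (N : Type) [AddCommGroup N] [Module ℂ N] (ξ : ExteriorAlgebra ℂ N) :
    Submodule ℂ (Vsp N) :=
  LinearMap.ker ((rho m N).flip ξ)

/-- The grade involution anticommutes with contraction. -/
theorem CliffordAlgebra.involute_contractLeft {R M : Type*} [CommRing R] [AddCommGroup M]
    [Module R M] {Q : QuadraticForm R M} (d : Module.Dual R M) (x : CliffordAlgebra Q) :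
    involute (contractLeft d x) = -contractLeft d (involute x) := by
  induction x using CliffordAlgebra.left_induction with
  | algebraMap r => simp
  | add x y hx hy => simp only [map_add, hx, hy, neg_add]
  | ι_mul x m hx =>
    simp only [contractLeft_ι_mul, map_sub, map_smul, map_mul, involute_ι, hx, neg_mul, map_neg]
    simp

theorem Qform_apply (N : Type) [AddCommGroup N] [Module ℂ N] (x : Vsp N) :
    Qform N x = x.2.1 x.1 - x.2.2 * x.2.2 := rfl

theorem rho_apply (m : ℕ) (N : Type) [AddCommGroup N] [Module ℂ N] (x : Vsp N)
    (ξ : CliffordAlgebra (0 : QuadraticForm ℂ N)) :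
    rho m N x ξ = CliffordAlgebra.ι 0 x.1 * ξ - CliffordAlgebra.contractLeft x.2.1 ξ +
      (x.2.2 * (-1) ^ m) • CliffordAlgebra.involute ξ := by
  rw [mul_smul]
  rfl

/-- The Clifford relation `ρ(x)² = -Q(x)`. -/
theorem rho_rho_apply (m : ℕ) (N : Type) [AddCommGroup N] [Module ℂ N] (x : Vsp N)
    (ξ : CliffordAlgebra (0 : QuadraticForm ℂ N)) :
    rho m N x (rho m N x ξ) = (-(Qform N x)) • ξ := by
  have hsign : (x.2.2 * (-1) ^ m) * (x.2.2 * (-1) ^ m) = x.2.2 * x.2.2 := by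
    rw [mul_mul_mul_comm, ← mul_pow]
    simp
  have hι : CliffordAlgebra.ι (0 : QuadraticForm ℂ N) x.1 *
      (CliffordAlgebra.ι (0 : QuadraticForm ℂ N) x.1 * ξ) = 0 := by
    rw [← mul_assoc, CliffordAlgebra.ι_sq_scalar]
    simp
  rw [rho_apply, rho_apply, Qform_apply, ← hsign]
  generalize x.2.2 * (-1) ^ m = s
  simp only [map_add, map_sub, map_smul, map_mul, mul_add, mul_sub, hι,
    CliffordAlgebra.contractLeft_ι_mul, CliffordAlgebra.contractLeft_contractLeft,
    CliffordAlgebra.involute_contractLeft, CliffordAlgebra.involute_ι,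
    CliffordAlgebra.involute_involute, mul_smul_comm, neg_mul]
  module

/-- the Clifford relation for `ρ` and the induced unique algebra
homomorphism from the Clifford algebra of `−Q` to `End(S)`. -/
theorem clifford_relation_and_unique_lift
    (m : ℕ) (hm : 0 < m) (N : Type) [AddCommGroup N] [Module ℂ N]
    [FiniteDimensional ℂ N] (hdim : Module.finrank ℂ N = m) :
    (∀ x : Vsp N,
        rho m N x ∘ₗ rho m N x =
          (-(Qform N x)) • (LinearMap.id : ExteriorAlgebra ℂ N →ₗ[ℂ] ExteriorAlgebra ℂ N)) ∧
    (∃! f : CliffordAlgebra (-(Qform N)) →ₐ[ℂ] Module.End ℂ (ExteriorAlgebra ℂ N),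
        ∀ x : Vsp N, f (CliffordAlgebra.ι (-(Qform N)) x) = rho m N x) := by
  have hsq : ∀ x : Vsp N, rho m N x ∘ₗ rho m N x =
      (-(Qform N x)) • (LinearMap.id : ExteriorAlgebra ℂ N →ₗ[ℂ] ExteriorAlgebra ℂ N) :=
    fun x => LinearMap.ext fun ξ => rho_rho_apply m N x ξ
  refine ⟨hsq, CliffordAlgebra.lift (-(Qform N)) ⟨rho m N, hsq⟩,
    fun x => CliffordAlgebra.lift_ι_apply _ _ x, fun f hf => ?_⟩
  exact (CliffordAlgebra.lift_unique _ _ f).mp (LinearMap.ext hf)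
end
end

section
/- The ℂ-algebra homomorphism ρ̂ from the Clifford algebra of (V, −Q) to End(S) determined by ρ̂(ι(x)) = ρ(x) for all x ∈ V is surjective; equivalently, S is an irreducible module for the Clifford algebra of the (2m+1)-dimensional nondegenerate quadratic space (V, −Q). -/
noncomputable section

open scoped TensorProduct

/-- **Burnside's theorem**: an algebra of endomorphisms acting irreducibly on a finite-dimensional
space over an algebraically closed field consists of all endomorphisms. -/
theorem Subalgebra.eq_top_of_isSimpleModule {K V : Type*} [Field K] [IsAlgClosed K]
    [AddCommGroup V] [Module K V] [FiniteDimensional K V] (A : Subalgebra K (Module.End K V))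
    [IsSimpleModule A V] : A = ⊤ := by
  refine eq_top_iff.mpr fun g _ => ?_
  let g' : Module.End (Module.End A V) V :=
    { toFun := g
      map_add' := map_add g
      map_smul' := fun e x => by
        obtain ⟨c, rfl⟩ := (IsSimpleModule.algebraMap_end_bijective_of_isAlgClosed K).2 e
        simp }
  obtain ⟨s, hs⟩ := Module.Finite.fg_top (R := K) (M := V)
  obtain ⟨a, ha⟩ := jacobson_density g' s
  have : g = a := LinearMap.ext_on hs fun x hx => ha x hx
  exact this ▸ a.2

namespace ExteriorAlgebra

open CliffordAlgebra (contractLeft)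

/-- The exterior algebra of a finite-dimensional space is finite-dimensional. -/
theorem finiteDimensional (K N : Type*) [Field K] [AddCommGroup N] [Module K N]
    [FiniteDimensional K N] : FiniteDimensional K (ExteriorAlgebra K N) := by
  have htop := (DirectSum.Decomposition.isInternal
    (fun n : ℕ => ⋀[K]^n N)).submodule_iSup_eq_top
  have hzero : ∀ n, Module.finrank K N < n → ⋀[K]^n N = ⊥ := fun n hn => by
    rw [← Submodule.finrank_eq_zero, exteriorPower.finrank_eq, Nat.choose_eq_zero_of_lt hn]
  have hle : (⊤ : Submodule K (ExteriorAlgebra K N)) ≤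
      ⨆ n ∈ Finset.range (Module.finrank K N + 1), ⋀[K]^n N := by
    rw [← htop]
    refine iSup_le fun n => ?_
    by_cases hn : Module.finrank K N < n
    · simp [hzero n hn]
    · exact le_biSup (fun n : ℕ => ⋀[K]^n N) (by simp; omega)
  rw [FiniteDimensional, Module.finite_def, ← top_le_iff.mp hle]
  exact Submodule.fg_biSup _ _ fun n _ => Module.Finite.iff_fg.mp inferInstance

variable {K N I : Type*} [Field K] [AddCommGroup N] [Module K N] [Fintype I]

/-- The degree operator `∑ i, e i ∧ ι_{e i *}` of the exterior algebra. -/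
def degreeOperator (b : Module.Basis I K N) : Module.End K (ExteriorAlgebra K N) :=
  ∑ i, LinearMap.mulLeft K (ι K (b i)) ∘ₗ contractLeft (Q := (0 : QuadraticForm K N)) (b.coord i)

theorem degreeOperator_apply (b : Module.Basis I K N) (x : ExteriorAlgebra K N) :
    degreeOperator b x =
      ∑ i, ι K (b i) * contractLeft (Q := (0 : QuadraticForm K N)) (b.coord i) x := by
  simp [degreeOperator]

theorem degreeOperator_ι_mul (b : Module.Basis I K N) (v : N) (x : ExteriorAlgebra K N) :
    degreeOperator b (ι K v * x) = ι K v * x + ι K v * degreeOperator b x := by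
  have hterm : ∀ i, ι K (b i) *
      contractLeft (Q := (0 : QuadraticForm K N)) (b.coord i) (ι K v * x) =
      ι K (b.coord i v • b i) * x + ι K v *
        (ι K (b i) * contractLeft (Q := (0 : QuadraticForm K N)) (b.coord i) x) := fun i => by
    have hanti : ι K (b i) * ι K v = -(ι K v * ι K (b i)) :=
      eq_neg_of_add_eq_zero_left (ι_add_mul_swap _ _)
    erw [CliffordAlgebra.contractLeft_ι_mul]
    rw [mul_sub, ← mul_assoc (ι K (b i)) (ι K v)]
    erw [hanti]
    rw [map_smul, smul_mul_assoc, mul_smul_comm, neg_mul, sub_neg_eq_add, mul_assoc]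
  rw [degreeOperator_apply, degreeOperator_apply, Finset.sum_congr rfl fun i _ => hterm i,
    Finset.sum_add_distrib, ← Finset.sum_mul, ← map_sum, ← Finset.mul_sum]
  congr 4
  exact b.sum_repr v

/-- Every element of the exterior algebra is the sum of a scalar and of eigenvectors of the degree
operator for positive integer eigenvalues. -/
theorem mem_one_sup_iSup_eigenspace (b : Module.Basis I K N) (x : ExteriorAlgebra K N) :
    x ∈ (1 : Submodule K (ExteriorAlgebra K N)) ⊔
      ⨆ n : ℕ, (degreeOperator b).eigenspace ((n + 1 : ℕ) : K) := by
  set M := ⨆ n : ℕ, (degreeOperator b).eigenspace ((n + 1 : ℕ) : K)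
  induction x using CliffordAlgebra.left_induction with
  | algebraMap r => exact Submodule.mem_sup_left (Submodule.mem_one.mpr ⟨r, rfl⟩)
  | add x y hx hy => exact add_mem hx hy
  | ι_mul x v hx =>
    refine Submodule.mem_sup_right ?_
    change ι K v * x ∈ M
    suffices h : (1 : Submodule K (ExteriorAlgebra K N)) ⊔ M ≤
        M.comap (LinearMap.mulLeft K (ι K v)) from h hx
    have hmul : ∀ (n : ℕ) (y : ExteriorAlgebra K N), degreeOperator b y = (n : K) • y →
        ι K v * y ∈ M := fun n y hy => by
      refine Submodule.mem_iSup_of_mem n (Module.End.mem_eigenspace_iff.mpr ?_)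
      rw [degreeOperator_ι_mul, hy, mul_smul_comm]
      push_cast
      rw [add_smul, one_smul, add_comm]
    refine sup_le ?_ (iSup_le fun n y hy => hmul (n + 1) y (Module.End.mem_eigenspace_iff.mp hy))
    intro y hy
    obtain ⟨r, rfl⟩ := Submodule.mem_one.mp hy
    refine hmul 0 _ ?_
    rw [degreeOperator_apply, Nat.cast_zero, zero_smul]
    refine Finset.sum_eq_zero fun i _ => ?_
    erw [CliffordAlgebra.contractLeft_algebraMap]
    exact mul_zero _

/-- In characteristic zero, an element killed by all contractions is a scalar. -/
theorem exists_algebraMap_eq_of_contractLeft_eq_zero [CharZero K] (b : Module.Basis I K N)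
    {x : ExteriorAlgebra K N}
    (hx : ∀ i, contractLeft (Q := (0 : QuadraticForm K N)) (b.coord i) x = 0) :
    ∃ r, algebraMap K (ExteriorAlgebra K N) r = x := by
  have hker : ∀ y : ExteriorAlgebra K N,
      (∀ i, contractLeft (Q := (0 : QuadraticForm K N)) (b.coord i) y = 0) →
      y ∈ (degreeOperator b).eigenspace (0 : K) := fun y hy => by
    rw [Module.End.mem_eigenspace_iff, degreeOperator_apply, zero_smul]
    exact Finset.sum_eq_zero fun i _ => by erw [hy i]; exact mul_zero _
  obtain ⟨y, hy, z, hz, rfl⟩ := Submodule.mem_sup.mp (mem_one_sup_iSup_eigenspace b x)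
  obtain ⟨r, rfl⟩ := Submodule.mem_one.mp hy
  have hz₀ : z ∈ (degreeOperator b).eigenspace (0 : K) := by
    simpa using sub_mem (hker _ hx)
      (hker _ fun i => CliffordAlgebra.contractLeft_algebraMap _ (b.coord i) r)
  have hle : ⨆ n : ℕ, (degreeOperator b).eigenspace ((n + 1 : ℕ) : K) ≤
      ⨆ c ≠ (0 : K), (degreeOperator b).eigenspace c :=
    iSup_le fun n => le_biSup (fun c : K => (degreeOperator b).eigenspace c)
      (Nat.cast_ne_zero.mpr n.succ_ne_zero)
  have hzero :=
    Submodule.disjoint_def.mp ((degreeOperator b).eigenspaces_iSupIndep 0) z hz₀ (hle hz)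
  exact ⟨r, by rw [hzero, add_zero]⟩

/-- A nonzero subspace stable under contractions contains `1`. -/
theorem one_mem_of_contractLeft_mem [CharZero K] [FiniteDimensional K N]
    {W : Submodule K (ExteriorAlgebra K N)} (hW : W ≠ ⊥)
    (hcontract : ∀ (φ : Module.Dual K N), ∀ x ∈ W,
      contractLeft (Q := (0 : QuadraticForm K N)) φ x ∈ W) : 1 ∈ W := by
  classical
  let b := Module.finBasis K N
  have hex : ∀ s : Finset (Fin (Module.finrank K N)), ∃ x ∈ W, x ≠ 0 ∧
      ∀ i ∈ s, contractLeft (Q := (0 : QuadraticForm K N)) (b.coord i) x = 0 := fun s => by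
    induction s using Finset.induction_on with
    | empty =>
      obtain ⟨x, hx, hx₀⟩ := Submodule.exists_mem_ne_zero_of_ne_bot hW
      exact ⟨x, hx, hx₀, by simp⟩
    | insert j s _ ih =>
      obtain ⟨x, hx, hx₀, hs⟩ := ih
      by_cases hj : contractLeft (Q := (0 : QuadraticForm K N)) (b.coord j) x = 0
      · exact ⟨x, hx, hx₀, Finset.forall_mem_insert _ _ _ |>.mpr ⟨hj, hs⟩⟩
      · refine ⟨_, hcontract (b.coord j) x hx, hj, Finset.forall_mem_insert _ _ _ |>.mpr
          ⟨CliffordAlgebra.contractLeft_contractLeft _ _, fun i hi => ?_⟩⟩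
        erw [CliffordAlgebra.contractLeft_comm, hs i hi, map_zero, neg_zero]
  obtain ⟨x, hx, hx₀, hcontr⟩ := hex Finset.univ
  obtain ⟨r, rfl⟩ := exists_algebraMap_eq_of_contractLeft_eq_zero b fun i => hcontr i (by simp)
  have hr : r ≠ 0 := fun h => hx₀ (by rw [h, map_zero])
  rw [Algebra.algebraMap_eq_smul_one] at hx
  exact (W.smul_mem_iff hr).mp hx

/-- A subspace containing `1` and stable under left multiplication by vectors is everything. -/
theorem eq_top_of_ι_mul_mem {W : Submodule K (ExteriorAlgebra K N)} (hone : 1 ∈ W)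
    (hmul : ∀ (v : N), ∀ x ∈ W, ι K v * x ∈ W) : W = ⊤ := by
  refine eq_top_iff.mpr fun x _ => ?_
  induction x using CliffordAlgebra.left_induction with
  | algebraMap r =>
    rw [Algebra.algebraMap_eq_smul_one]
    exact W.smul_mem r hone
  | add x y hx hy => exact add_mem (hx trivial) (hy trivial)
  | ι_mul x v hx => exact hmul v x (hx trivial)

end ExteriorAlgebra

theorem rho_vector (m : ℕ) {N : Type} [AddCommGroup N] [Module ℂ N] (v : N)
    (x : ExteriorAlgebra ℂ N) : rho m N (v, 0, 0) x = ExteriorAlgebra.ι ℂ v * x := by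
  simp [rho]

theorem rho_covector (m : ℕ) {N : Type} [AddCommGroup N] [Module ℂ N] (φ : N →ₗ[ℂ] ℂ)
    (x : ExteriorAlgebra ℂ N) :
    rho m N (0, φ, 0) x = -CliffordAlgebra.contractLeft (Q := (0 : QuadraticForm ℂ N)) φ x := by
  simp [rho]

/-- any algebra homomorphism `ρ̂` from the Clifford algebra of `−Q` to
`End(S)` with `ρ̂(ι(x)) = ρ(x)` is surjective, i.e. `S` is an irreducible Clifford module. -/
theorem clifford_lift_surjective
    (m : ℕ) (hm : 0 < m) (N : Type) [AddCommGroup N] [Module ℂ N]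
    [FiniteDimensional ℂ N] (hdim : Module.finrank ℂ N = m) :
    ∀ f : CliffordAlgebra (-(Qform N)) →ₐ[ℂ] Module.End ℂ (ExteriorAlgebra ℂ N),
      (∀ x : Vsp N, f (CliffordAlgebra.ι (-(Qform N)) x) = rho m N x) →
      Function.Surjective f := by
  intro f hf
  have := ExteriorAlgebra.finiteDimensional ℂ N
  have hsimple : IsSimpleModule f.range (ExteriorAlgebra ℂ N) := by
    have hmem : ∀ (W : Submodule f.range (ExteriorAlgebra ℂ N)) (v : Vsp N), ∀ x ∈ W,
        rho m N v x ∈ W := fun W v x hx => W.smul_mem ⟨rho m N v, _, hf v⟩ hx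
    refine (isSimpleModule_iff _ _).mpr { eq_bot_or_eq_top := fun W => ?_ }
    refine or_iff_not_imp_left.mpr fun hW => ?_
    rw [← Submodule.restrictScalars_eq_top_iff ℂ]
    refine ExteriorAlgebra.eq_top_of_ι_mul_mem
      (ExteriorAlgebra.one_mem_of_contractLeft_mem
        (mt (Submodule.restrictScalars_eq_bot_iff _ _ _).mp hW) fun φ x hx => ?_) fun v x hx => ?_
    · exact neg_mem_iff.mp (rho_covector m φ x ▸ hmem W (0, φ, 0) x hx)
    · exact rho_vector m v x ▸ hmem W (v, 0, 0) x hx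
  exact AlgHom.range_eq_top f |>.mp (Subalgebra.eq_top_of_isSimpleModule f.range)
end
end

section
/- The restriction of ρ̂ to the even subalgebra of the Clifford algebra of (V, −Q) is an algebra isomorphism onto End(S); in particular the even Clifford subalgebra of a (2m+1)-dimensional nondegenerate complex quadratic space is isomorphic to the algebra of 2^m × 2^m complex matrices. -/
noncomputable section

open scoped TensorProduct

/-- **Burnside's theorem**: a subalgebra of endomorphisms of a nonzero finite-dimensional space over
an algebraically closed field with no proper nonzero invariant subspace is the whole algebra. -/
theorem Subalgebra.eq_top_of_forall_invariant {K V : Type*} [Field K] [IsAlgClosed K]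
    [AddCommGroup V] [Module K V] [FiniteDimensional K V] [Nontrivial V]
    (A : Subalgebra K (Module.End K V))
    (h : ∀ W : Submodule K V, (∀ a ∈ A, ∀ w ∈ W, a w ∈ W) → W ≠ ⊥ → W = ⊤) : A = ⊤ := by
  have : IsSimpleModule A V := by
    refine (isSimpleModule_iff A V).2 { eq_bot_or_eq_top := fun W => ?_ }
    refine or_iff_not_imp_left.2 fun hW => ?_
    have := h (W.restrictScalars K) (fun a ha w hw => W.smul_mem (⟨a, ha⟩ : A) hw) (by simpa)
    simpa using this
  have hsurj := (IsSimpleModule.algebraMap_end_bijective_of_isAlgClosed (A := A) (V := V) K).2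
  refine eq_top_iff.2 fun T _ => ?_
  let T' : Module.End (Module.End A V) V :=
    { T with
      map_smul' := fun c x => by
        obtain ⟨k, rfl⟩ := hsurj c
        exact T.map_smul k x }
  let b := Module.finBasis K V
  classical
  obtain ⟨r, hr⟩ := jacobson_density T' (Finset.univ.image b)
  have : T = r := b.ext fun i => hr (b i) (by simp)
  rw [this]
  exact r.2

open CliffordAlgebra in
theorem CliffordAlgebra.contractLeft_involute {R M : Type*} [CommRing R] [AddCommGroup M]
    [Module R M] {Q : QuadraticForm R M} (d : Module.Dual R M) (x : CliffordAlgebra Q) :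
    contractLeft d (involute x) = -involute (contractLeft d x) := by
  induction x using CliffordAlgebra.left_induction with
  | algebraMap r => simp
  | add x y hx hy => simp only [map_add, hx, hy, neg_add]
  | ι_mul x v hx =>
    simp only [map_mul, involute_ι, neg_mul, map_neg, contractLeft_ι_mul, hx, map_sub, map_smul,
      mul_neg]

/-- Twice the dimension of the even part is the dimension of the Clifford algebra, as soon as there
is a vector of square one. -/
theorem CliffordAlgebra.two_mul_finrank_evenOdd_zero {K M : Type*} [Field K] [AddCommGroup M]
    [Module K M] {Q : QuadraticForm K M} [FiniteDimensional K (CliffordAlgebra Q)] (u : M)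
    (hu : Q u = 1) :
    2 * Module.finrank K (evenOdd Q 0) = Module.finrank K (CliffordAlgebra Q) := by
  have huu : ι Q u * ι Q u = 1 := by rw [ι_sq_scalar, hu, map_one]
  have hmem (i : ZMod 2) (x) (hx : x ∈ evenOdd Q i) : ι Q u * x ∈ evenOdd Q (1 + i) :=
    SetLike.mul_mem_graded (ι_mem_evenOdd_one Q u) hx
  have hcancel (x : CliffordAlgebra Q) : ι Q u * (ι Q u * x) = x := by
    rw [← mul_assoc, huu, one_mul]
  let e : evenOdd Q 0 ≃ₗ[K] evenOdd Q 1 :=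
    LinearEquiv.ofLinearMap
      ((LinearMap.mulLeft K (ι Q u)).restrict (fun x hx => hmem 0 x hx))
      ((LinearMap.mulLeft K (ι Q u)).restrict (fun x hx => hmem 1 x hx))
      (LinearMap.ext fun x => Subtype.ext (hcancel x))
      (LinearMap.ext fun x => Subtype.ext (hcancel x))
  rw [← Submodule.finrank_add_eq_of_isCompl (evenOdd_isCompl Q), ← e.finrank_eq, two_mul]

theorem ExteriorAlgebra.finite_and_finrank_eq (K M : Type*) [Field K] [AddCommGroup M]
    [Module K M] [FiniteDimensional K M] :
    Module.Finite K (ExteriorAlgebra K M) ∧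
      Module.finrank K (ExteriorAlgebra K M) = 2 ^ Module.finrank K M := by
  let b := (Module.finBasis K M).ExteriorAlgebra
  exact ⟨Module.Finite.of_basis b, by simp [Module.finrank_eq_card_basis b]⟩

open CliffordAlgebra in
/-- The Euler operator `∑ i, b i ∧ ι_{b i}^*` acts on `⋀^k M` as multiplication by `k`. -/
theorem ExteriorAlgebra.sum_ι_mul_contractLeft {R M I : Type*} [CommRing R] [AddCommGroup M]
    [Module R M] [Fintype I] (b : Module.Basis I R M) (k : ℕ) (x : ExteriorAlgebra R M)
    (hx : x ∈ ⋀[R]^k M) :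
    ∑ i, ι R (b i) * contractLeft (Q := (0 : QuadraticForm R M)) (b.coord i) x = k • x := by
  induction hx using Submodule.pow_induction_on_left' with
  | algebraMap r => simp
  | add x y i hx hy ihx ihy =>
    simp only [map_add, mul_add, Finset.sum_add_distrib, ihx, ihy, smul_add]
  | mem_mul m hm i x hx ih =>
    obtain ⟨v, rfl⟩ := hm
    have h (j : I) : ι R (b j) * contractLeft (Q := (0 : QuadraticForm R M)) (b.coord j) (ι R v * x)
        = ι R (b.repr v j • b j) * x
          + ι R v * (ι R (b j) * contractLeft (Q := (0 : QuadraticForm R M)) (b.coord j) x) := by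
      have h1 : ι R (b j) * ι R v = - (ι R v * ι R (b j)) :=
        eq_neg_of_add_eq_zero_left (ι_add_mul_swap _ _)
      have h2 := contractLeft_ι_mul (Q := (0 : QuadraticForm R M)) (b.coord j) v x
      refine (congrArg (ι R (b j) * ·) h2).trans ?_
      change ι R (b j) * (b.repr v j • x - ι R v * _) = _
      rw [mul_sub, ← mul_assoc, h1, map_smul]
      simp [mul_assoc]
    simp_rw [h, Finset.sum_add_distrib, ← Finset.mul_sum, ih, ← Finset.sum_mul,
      ← map_sum, b.sum_repr]
    rw [succ_nsmul', mul_smul_comm]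

open CliffordAlgebra in
/-- An element of the exterior algebra killed by all contractions is a scalar. -/
theorem ExteriorAlgebra.exists_eq_algebraMap_of_contractLeft_eq_zero {K M I : Type*} [Field K]
    [CharZero K] [AddCommGroup M] [Module K M] [Fintype I] (b : Module.Basis I K M)
    (x : ExteriorAlgebra K M)
    (hx : ∀ i, contractLeft (Q := (0 : QuadraticForm K M)) (b.coord i) x = 0) :
    ∃ r, x = algebraMap K _ r := by
  classical
  let D : ExteriorAlgebra K M →ₗ[K] ExteriorAlgebra K M :=
    ∑ i, LinearMap.mulLeft K (ι K (b i)) ∘ₗ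
      contractLeft (Q := (0 : QuadraticForm K M)) (b.coord i)
  have hD (y) :
      D y = ∑ i, ι K (b i) * contractLeft (Q := (0 : QuadraticForm K M)) (b.coord i) y := by
    simp [D]
  let p := DirectSum.decompose (fun n => ⋀[K]^n M) x
  have hDx : ∑ n ∈ p.support, ((n • p n : ⋀[K]^n M) : ExteriorAlgebra K M) = 0 := by
    calc _ = ∑ n ∈ p.support, D (p n) := Finset.sum_congr rfl fun n _ => by
            rw [hD, sum_ι_mul_contractLeft b n _ (p n).2]; rfl
      _ = D x := by rw [← map_sum, DirectSum.sum_support_decompose]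
      _ = 0 := by simp [hD, hx]
  have hp (n : ℕ) (hn : n ∈ p.support) : n = 0 := by
    have h := congrArg (fun y => DirectSum.decompose (fun n => ⋀[K]^n M) y n) hDx
    simp only [DirectSum.decompose_sum, DirectSum.decompose_coe, DirectSum.decompose_zero,
      DirectSum.sum_apply, DirectSum.zero_apply] at h
    rw [Finset.sum_eq_single_of_mem n hn fun k _ hk => DirectSum.of_eq_of_ne _ _ _ hk.symm,
      DirectSum.of_eq_same, ← Nat.cast_smul_eq_nsmul K, smul_eq_zero] at h
    exact_mod_cast h.resolve_right (DFinsupp.mem_support_iff.1 hn)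
  have hmem : x ∈ ⋀[K]^0 M := by
    rw [← DirectSum.sum_support_decompose (fun n => ⋀[K]^n M) x]
    exact Submodule.sum_mem _ fun n hn => hp n hn ▸ (p n).2
  obtain ⟨r, hr⟩ := Submodule.mem_one.1 ((pow_zero (LinearMap.range (ι K (M := M)))).le hmem)
  exact ⟨r, hr.symm⟩

theorem rho_apply_s2 (m : ℕ) (N : Type) [AddCommGroup N] [Module ℂ N] (v : N) (φ : N →ₗ[ℂ] ℂ) (t : ℂ)
    (ξ : ExteriorAlgebra ℂ N) :
    rho m N (v, φ, t) ξ = ExteriorAlgebra.ι ℂ v * ξ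
      - CliffordAlgebra.contractLeft (Q := (0 : QuadraticForm ℂ N)) φ ξ + t • sigmaMap m N ξ :=
  rfl

theorem sigmaMap_sigmaMap (m : ℕ) (N : Type) [AddCommGroup N] [Module ℂ N]
    (ξ : ExteriorAlgebra ℂ N) : sigmaMap m N (sigmaMap m N ξ) = ξ := by
  have h : sigmaMap m N (sigmaMap m N ξ) = ((-1 : ℂ) ^ m) • ((-1 : ℂ) ^ m) • ξ := by
    simp only [sigmaMap, LinearMap.smul_apply, map_smul]
    congr 2
    exact CliffordAlgebra.involute_involute ξ
  rw [h, smul_smul, ← mul_pow]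
  simp

theorem sigmaMap_algebraMap (m : ℕ) (N : Type) [AddCommGroup N] [Module ℂ N] (r : ℂ) :
    sigmaMap m N (algebraMap ℂ _ r) = ((-1 : ℂ) ^ m) • algebraMap ℂ _ r :=
  congrArg (((-1 : ℂ) ^ m) • ·)
    ((CliffordAlgebra.involute (Q := (0 : QuadraticForm ℂ N))).commutes r)

theorem sigmaMap_ι_mul (m : ℕ) (N : Type) [AddCommGroup N] [Module ℂ N] (v : N)
    (ξ : ExteriorAlgebra ℂ N) :
    sigmaMap m N (ExteriorAlgebra.ι ℂ v * ξ) = -(ExteriorAlgebra.ι ℂ v * sigmaMap m N ξ) := by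
  have h : CliffordAlgebra.involute (Q := (0 : QuadraticForm ℂ N)) (ExteriorAlgebra.ι ℂ v * ξ) =
      -(ExteriorAlgebra.ι ℂ v * CliffordAlgebra.involute (Q := (0 : QuadraticForm ℂ N)) ξ) :=
    (map_mul _ _ _).trans (by
      rw [← neg_mul]
      exact congrArg (· * _) (CliffordAlgebra.involute_ι v))
  refine (congrArg (((-1 : ℂ) ^ m) • ·) h).trans ?_
  rw [smul_neg, ← mul_smul_comm]
  rfl

theorem contractLeft_sigmaMap (m : ℕ) (N : Type) [AddCommGroup N] [Module ℂ N] (φ : N →ₗ[ℂ] ℂ)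
    (ξ : ExteriorAlgebra ℂ N) :
    CliffordAlgebra.contractLeft (Q := (0 : QuadraticForm ℂ N)) φ (sigmaMap m N ξ) =
      -sigmaMap m N (CliffordAlgebra.contractLeft (Q := (0 : QuadraticForm ℂ N)) φ ξ) := by
  have h := CliffordAlgebra.contractLeft_involute (Q := (0 : QuadraticForm ℂ N)) φ ξ
  refine (map_smul (CliffordAlgebra.contractLeft (Q := (0 : QuadraticForm ℂ N)) φ) _ _).trans ?_
  refine (congrArg (((-1 : ℂ) ^ m) • ·) h).trans ?_
  rw [smul_neg]
  rfl

/-- A nonzero subspace of spinors stable under products of two Clifford operators is everything. -/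
theorem eq_top_of_rho_mul_rho_invariant (m : ℕ) (N : Type) [AddCommGroup N] [Module ℂ N]
    [FiniteDimensional ℂ N] (W : Submodule ℂ (ExteriorAlgebra ℂ N))
    (hW : ∀ x y : Vsp N, ∀ ξ ∈ W, rho m N x (rho m N y ξ) ∈ W) (hne : W ≠ ⊥) : W = ⊤ := by
  classical
  have hwedge (v : N) (ξ) (hξ : ξ ∈ W) : sigmaMap m N (ExteriorAlgebra.ι ℂ v * ξ) ∈ W := by
    simpa [rho_apply_s2] using hW (0, 0, 1) (v, 0, 0) ξ hξ
  have hcontract (φ : N →ₗ[ℂ] ℂ) (ξ) (hξ : ξ ∈ W) :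
      sigmaMap m N (CliffordAlgebra.contractLeft (Q := (0 : QuadraticForm ℂ N)) φ ξ) ∈ W := by
    simpa [rho_apply_s2] using hW (0, 0, 1) (0, φ, 0) ξ hξ
  let b := Module.finBasis ℂ N
  have hkill (s : Finset (Fin (Module.finrank ℂ N))) : ∃ ξ ∈ W, ξ ≠ 0 ∧ ∀ i ∈ s,
      CliffordAlgebra.contractLeft (Q := (0 : QuadraticForm ℂ N)) (b.coord i) ξ = 0 := by
    induction s using Finset.induction_on with
    | empty =>
      obtain ⟨ξ, hξ, h0⟩ := W.exists_mem_ne_zero_of_ne_bot hne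
      exact ⟨ξ, hξ, h0, by simp⟩
    | insert j s _ ih =>
      obtain ⟨ξ, hξ, h0, hs⟩ := ih
      by_cases hj : CliffordAlgebra.contractLeft (Q := (0 : QuadraticForm ℂ N)) (b.coord j) ξ = 0
      · exact ⟨ξ, hξ, h0, by simpa [hj] using hs⟩
      · refine ⟨_, hcontract (b.coord j) ξ hξ, fun h => hj ?_, fun i hi => ?_⟩
        · have := congrArg (sigmaMap m N) h
          rwa [sigmaMap_sigmaMap, map_zero] at this
        · rw [contractLeft_sigmaMap]
          have : CliffordAlgebra.contractLeft (Q := (0 : QuadraticForm ℂ N)) (b.coord i)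
              (CliffordAlgebra.contractLeft (Q := (0 : QuadraticForm ℂ N)) (b.coord j) ξ) = 0 := by
            rcases Finset.mem_insert.1 hi with rfl | hi
            · exact CliffordAlgebra.contractLeft_contractLeft _ _
            · rw [CliffordAlgebra.contractLeft_comm, hs i hi, map_zero, neg_zero]
          exact (congrArg (fun y => -sigmaMap m N y) this).trans (by simp)
  obtain ⟨ξ, hξ, h0, hs⟩ := hkill Finset.univ
  obtain ⟨r, rfl⟩ := ExteriorAlgebra.exists_eq_algebraMap_of_contractLeft_eq_zero b ξ
    fun i => hs i (Finset.mem_univ i)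
  have hr : r ≠ 0 := by rintro rfl; exact h0 (map_zero _)
  have hscalar (c : ℂ) : algebraMap ℂ (ExteriorAlgebra ℂ N) c ∈ W := by
    have := W.smul_mem (c / r) hξ
    rwa [Algebra.smul_def, ← map_mul, div_mul_cancel₀ c hr] at this
  refine eq_top_iff.2 fun x _ => ?_
  suffices x ∈ W ∧ sigmaMap m N x ∈ W from this.1
  induction x using CliffordAlgebra.left_induction with
  | algebraMap c =>
    refine ⟨hscalar c, ?_⟩
    exact (sigmaMap_algebraMap m N c).symm ▸ W.smul_mem _ (hscalar c)
  | add x y hx hy =>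
    exact ⟨W.add_mem (hx trivial).1 (hy trivial).1,
      (map_add (sigmaMap m N) x y).symm ▸ W.add_mem (hx trivial).2 (hy trivial).2⟩
  | ι_mul x v hx =>
    refine ⟨?_, hwedge v x (hx trivial).1⟩
    have h := W.neg_mem (hwedge v _ (hx trivial).2)
    rwa [sigmaMap_ι_mul, sigmaMap_sigmaMap, neg_neg] at h

/-- the restriction of `ρ̂` to the even subalgebra (generated by the
products `ι(x)·ι(y)`) is an algebra isomorphism onto `End(S)`; in particular the even
Clifford subalgebra is isomorphic to the `2^m × 2^m` complex matrix algebra. -/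
theorem even_subalgebra_iso
    (m : ℕ) (hm : 0 < m) (N : Type) [AddCommGroup N] [Module ℂ N]
    [FiniteDimensional ℂ N] (hdim : Module.finrank ℂ N = m) :
    ∀ f : CliffordAlgebra (-(Qform N)) →ₐ[ℂ] Module.End ℂ (ExteriorAlgebra ℂ N),
      (∀ x : Vsp N, f (CliffordAlgebra.ι (-(Qform N)) x) = rho m N x) →
      (Function.Bijective
          (f.comp (Algebra.adjoin ℂ
            {a : CliffordAlgebra (-(Qform N)) | ∃ x y : Vsp N,
              a = CliffordAlgebra.ι (-(Qform N)) x * CliffordAlgebra.ι (-(Qform N)) y}).val) ∧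
        Nonempty
          ((Algebra.adjoin ℂ
            {a : CliffordAlgebra (-(Qform N)) | ∃ x y : Vsp N,
              a = CliffordAlgebra.ι (-(Qform N)) x * CliffordAlgebra.ι (-(Qform N)) y}) ≃ₐ[ℂ]
            Matrix (Fin (2 ^ m)) (Fin (2 ^ m)) ℂ)) := by
  intro f hf
  obtain ⟨hfin, hrank⟩ := ExteriorAlgebra.finite_and_finrank_eq ℂ N
  rw [hdim] at hrank
  set E : Subalgebra ℂ (CliffordAlgebra (-(Qform N))) := Algebra.adjoin ℂ
    {a | ∃ x y : Vsp N,
      a = CliffordAlgebra.ι (-(Qform N)) x * CliffordAlgebra.ι (-(Qform N)) y}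
  let g := f.comp E.val
  have hrange : g.range = ⊤ := by
    refine Subalgebra.eq_top_of_forall_invariant _ fun W hW hne =>
      eq_top_of_rho_mul_rho_invariant m N W (fun x y ξ hξ => ?_) hne
    have := hW (g ⟨_, Algebra.subset_adjoin ⟨x, y, rfl⟩⟩) ⟨_, rfl⟩ ξ hξ
    simpa [g, hf] using this
  have hsurj : Function.Surjective g := AlgHom.range_eq_top g |>.1 hrange
  have h2 : Invertible (2 : ℂ) := invertibleOfNonzero two_ne_zero
  let e := CliffordAlgebra.equivExterior (-(Qform N))
  obtain ⟨hfinV, hrankV⟩ := ExteriorAlgebra.finite_and_finrank_eq ℂ (Vsp N)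
  have hfinCl : Module.Finite ℂ (CliffordAlgebra (-(Qform N))) := Module.Finite.equiv e.symm
  have hrankCl : Module.finrank ℂ (CliffordAlgebra (-(Qform N))) = 2 * 2 ^ (m + m) := by
    rw [e.finrank_eq, hrankV, ← pow_succ']
    simp [hdim, Module.finrank_prod, add_assoc]
  have hu : (-(Qform N)) ((0, 0, 1) : Vsp N) = 1 := by
    simp [Qform, Bform]
  have heven := CliffordAlgebra.two_mul_finrank_evenOdd_zero _ hu
  have hle : Subalgebra.toSubmodule E ≤ CliffordAlgebra.evenOdd (-(Qform N)) 0 := by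
    rw [← CliffordAlgebra.even_toSubmodule]
    refine Subalgebra.toSubmodule.monotone (Algebra.adjoin_le ?_)
    rintro _ ⟨x, y, rfl⟩
    exact CliffordAlgebra.ι_mul_ι_mem_evenOdd_zero _ x y
  have hEle : Module.finrank ℂ E ≤ Module.finrank ℂ (Module.End ℂ (ExteriorAlgebra ℂ N)) := by
    have h1 : Module.finrank ℂ E ≤ _ := Submodule.finrank_mono hle
    rw [Module.finrank_linearMap, hrank, ← pow_add]
    omega
  have hEeq : Module.finrank ℂ E = Module.finrank ℂ (Module.End ℂ (ExteriorAlgebra ℂ N)) :=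
    le_antisymm hEle (LinearMap.finrank_le_finrank_of_surjective (f := g.toLinearMap) hsurj)
  have hbij : Function.Bijective g :=
    ⟨(LinearMap.injective_iff_surjective_of_finrank_eq_finrank (f := g.toLinearMap) hEeq).2 hsurj,
      hsurj⟩
  exact ⟨hbij, ⟨(AlgEquiv.ofBijective g hbij).trans
    (algEquivMatrix (Module.finBasisOfFinrankEq ℂ (ExteriorAlgebra ℂ N) hrank))⟩⟩
end
end

section
/- Let ξ ∈ S be pure and let ξ₁, ξ₂ be any two nonzero elements of the subspace {ρ(x)(ξ) : x ∈ V} (so ξ₁ and ξ₂ are pure). Then their associated γ-planes intersect in a totally isotropic subspace of codimension at most 2 in each: dim(K_{ξ₁} ∩ K_{ξ₂}) ≥ m − 2. -/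
noncomputable section

open scoped TensorProduct

/-- Contraction by a functional anticommutes with the grade involution. -/
theorem contractLeft_involute_zero (N : Type) [AddCommGroup N] [Module ℂ N]
    (φ : N →ₗ[ℂ] ℂ) (η : ExteriorAlgebra ℂ N) :
    CliffordAlgebra.contractLeft (Q := (0 : QuadraticForm ℂ N)) φ
        (CliffordAlgebra.involute (Q := (0 : QuadraticForm ℂ N)) η) =
      -CliffordAlgebra.involute (Q := (0 : QuadraticForm ℂ N))
        (CliffordAlgebra.contractLeft (Q := (0 : QuadraticForm ℂ N)) φ η) := by
  induction η using CliffordAlgebra.left_induction with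
  | algebraMap r => simp [CliffordAlgebra.contractLeft_algebraMap]
  | add x y hx hy => simp only [map_add, hx, hy, neg_add]
  | ι_mul x v hx =>
    simp only [map_mul, CliffordAlgebra.involute_ι, neg_mul, map_neg,
      CliffordAlgebra.contractLeft_ι_mul, map_sub, map_smul, hx]
    simp

/-- The Clifford relation `ρ(x)² = -Q(x)`. -/
theorem rho_rho_self (m : ℕ) (N : Type) [AddCommGroup N] [Module ℂ N] (x : Vsp N)
    (η : ExteriorAlgebra ℂ N) :
    rho m N x (rho m N x η) = -(Bform N x x) • η := by
  obtain ⟨v, φ, t⟩ := x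
  have hsq : (-1 : ℂ) ^ m * (-1 : ℂ) ^ m = 1 := by rw [← mul_pow]; simp
  have hB : Bform N (v, φ, t) (v, φ, t) = φ v - t * t := rfl
  let a : CliffordAlgebra (0 : QuadraticForm ℂ N) →ₗ[ℂ] CliffordAlgebra (0 : QuadraticForm ℂ N) :=
    LinearMap.mulLeft ℂ (CliffordAlgebra.ι (0 : QuadraticForm ℂ N) v)
  have hrho (θ : CliffordAlgebra (0 : QuadraticForm ℂ N)) : rho m N (v, φ, t) θ =
      a θ - CliffordAlgebra.contractLeft φ θ +
        t • ((-1 : ℂ) ^ m • CliffordAlgebra.involute θ) := rfl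
  have haa : a (a η) = 0 := by
    simp only [a, LinearMap.mulLeft_apply]
    rw [← mul_assoc, CliffordAlgebra.ι_sq_scalar]; simp
  have hda : CliffordAlgebra.contractLeft φ (a η) =
      φ v • η - a (CliffordAlgebra.contractLeft φ η) :=
    CliffordAlgebra.contractLeft_ι_mul _ _ _
  have hsa : CliffordAlgebra.involute (a η) = -a (CliffordAlgebra.involute η) := by
    simp [a]
  rw [hB, hrho, hrho]
  simp only [map_add, map_sub, map_smul, haa, hda, hsa,
    CliffordAlgebra.contractLeft_contractLeft, CliffordAlgebra.involute_involute,
    contractLeft_involute_zero]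
  linear_combination (norm := module) (t * t) • congrArg (fun z : ℂ => z • η) hsq

/-- The polarized Clifford relation. -/
theorem rho_rho_add_rho_rho (m : ℕ) (N : Type) [AddCommGroup N] [Module ℂ N] (x y : Vsp N)
    (η : ExteriorAlgebra ℂ N) :
    rho m N x (rho m N y η) + rho m N y (rho m N x η) =
      -(Bform N x y + Bform N y x) • η := by
  have h := rho_rho_self m N (x + y) η
  have hx := rho_rho_self m N x η
  have hy := rho_rho_self m N y η
  simp only [map_add, LinearMap.add_apply] at h
  linear_combination (norm := module) h - hx - hy

/-- An annihilator of `ξ` that is orthogonal to `x` also annihilates `ρ(x)ξ`. -/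
theorem mem_Kker_rho_of_orthogonal (m : ℕ) (N : Type) [AddCommGroup N] [Module ℂ N]
    {x k : Vsp N} {ξ : ExteriorAlgebra ℂ N} (hk : k ∈ Kker m N ξ)
    (hkx : Bform N k x + Bform N x k = 0) : k ∈ Kker m N (rho m N x ξ) := by
  have hk' : rho m N k ξ = 0 := hk
  have h := rho_rho_add_rho_rho m N k x ξ
  rw [hk', hkx] at h
  change rho m N k (rho m N x ξ) = 0
  simpa using h

/-- The common zeros of two functionals on a finite-dimensional subspace have codimension at
most two. -/
theorem finrank_sub_two_le_of_forall_mem {V : Type*} [AddCommGroup V] [Module ℂ V]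
    [FiniteDimensional ℂ V] (K L : Submodule ℂ V) (f g : V →ₗ[ℂ] ℂ)
    (h : ∀ k ∈ K, f k = 0 → g k = 0 → k ∈ L) :
    Module.finrank ℂ K - 2 ≤ Module.finrank ℂ L := by
  let F : K →ₗ[ℂ] ℂ × ℂ := (f.prod g).domRestrict K
  have hrank := F.finrank_range_add_finrank_ker
  have hrange : Module.finrank ℂ (LinearMap.range F) ≤ 2 :=
    (Submodule.finrank_le _).trans (by simp)
  have hle : (LinearMap.ker F).map K.subtype ≤ L := by
    rintro _ ⟨k, hk, rfl⟩
    have hk' : (f k, g k) = ((0, 0) : ℂ × ℂ) := hk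
    exact h k k.2 (congrArg Prod.fst hk') (congrArg Prod.snd hk')
  have hker := Submodule.finrank_mono hle
  rw [Submodule.finrank_map_subtype_eq] at hker
  omega

/-- the γ-planes of any two nonzero elements of the image
`{ρ(x)ξ : x ∈ V}` of a pure spinor `ξ` intersect in codimension at most `2`. -/
theorem image_spinors_intersect
    (m : ℕ) (hm : 0 < m) (N : Type) [AddCommGroup N] [Module ℂ N]
    [FiniteDimensional ℂ N] (hdim : Module.finrank ℂ N = m)
    (ξ : ExteriorAlgebra ℂ N) (hξ0 : ξ ≠ 0)
    (hξ : Module.finrank ℂ (Kker m N ξ) = m) :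
    ∀ ξ₁ ∈ LinearMap.range ((rho m N).flip ξ),
      ∀ ξ₂ ∈ LinearMap.range ((rho m N).flip ξ), ξ₁ ≠ 0 → ξ₂ ≠ 0 →
        m - 2 ≤ Module.finrank ℂ (Kker m N ξ₁ ⊓ Kker m N ξ₂ : Submodule ℂ (Vsp N)) := by
  rintro _ ⟨x₁, rfl⟩ _ ⟨x₂, rfl⟩ - -
  have h := finrank_sub_two_le_of_forall_mem (Kker m N ξ)
    (Kker m N (rho m N x₁ ξ) ⊓ Kker m N (rho m N x₂ ξ))
    ((Bform N).flip x₁ + Bform N x₁) ((Bform N).flip x₂ + Bform N x₂)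
    fun k hk h₁ h₂ => ⟨mem_Kker_rho_of_orthogonal m N hk h₁, mem_Kker_rho_of_orthogonal m N hk h₂⟩
  rwa [hξ] at h
end
end
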